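/- Let U ∈ C₀^∞(Ω̄∖M) and V_t ∈ C^∞(Ω̄_t∖M) for t = 1,2. Then the following nonlocal Green formula in the dihedral angle Ω holds: Σ_{t=1,2} ∫_{Ω_t} (−ΔU)·conj(V_t) dx + ∫_{Γ₁} (U + α·U(χ₁₂ r, φ+φ₁₂, z))·conj(∂V₁/∂n₁) dΓ + ∫_{Γ₃} U·conj(∂V₂/∂n₃) dΓ + ∫_{Γ₂} (∂U/∂n₂)·(conj(V₁) − conj(V₂)) dΓ = Σ_{t=1,2} ∫_{Ω_t} U·conj(−ΔV_t) dx + ∫_{Γ₁} (∂U/∂n₁)·conj(V₁) dΓ + ∫_{Γ₃} (∂U/∂n₃)·conj(V₂) dΓ + ∫_{Γ₂} U·conj( ∂V₁/∂n₂ − ∂V₂/∂n₂ + α·χ'₂₁·(∂V₁/∂n₁)(χ'₂₁ r, φ+φ'₂₁, z) ) dΓ. -/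

import Mathlib

open MeasureTheory Real Set ComplexConjugate

noncomputable section

/-- Open plane sector `{(r cos θ, r sin θ) : r > 0, a < θ < b}` (polar coordinates). -/
def sector (a b : ℝ) : Set (ℝ × ℝ) :=
  {y | ∃ r θ : ℝ, 0 < r ∧ a < θ ∧ θ < b ∧ y = (r * Real.cos θ, r * Real.sin θ)}

variable (d : ℕ)

/-- The dihedral angle `K × ℝ^d` over a plane sector. -/
def dihedral (a b : ℝ) : Set ((ℝ × ℝ) × (Fin d → ℝ)) :=
  (sector a b) ×ˢ (Set.univ : Set (Fin d → ℝ))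

/-- The edge `M = {y = 0} × ℝ^d`. -/
def edge : Set ((ℝ × ℝ) × (Fin d → ℝ)) :=
  ({0} : Set (ℝ × ℝ)) ×ˢ (Set.univ : Set (Fin d → ℝ))

/-- Directional derivative of `W` in a fixed direction `v`. -/
def dd3 (W : (ℝ × ℝ) × (Fin d → ℝ) → ℂ) (v : (ℝ × ℝ) × (Fin d → ℝ))
    (x : (ℝ × ℝ) × (Fin d → ℝ)) : ℂ := fderiv ℝ W x v

/-- Laplacian in all `2 + d` variables. -/
def lap3 (W : (ℝ × ℝ) × (Fin d → ℝ) → ℂ) (x : (ℝ × ℝ) × (Fin d → ℝ)) : ℂ :=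
  dd3 d (dd3 d W ((1, 0), 0)) ((1, 0), 0) x +
  dd3 d (dd3 d W ((0, 1), 0)) ((0, 1), 0) x +
  ∑ i : Fin d, dd3 d (dd3 d W (0, Pi.single i 1)) (0, Pi.single i 1) x

/-- Rotation by the angle `ψ` and dilation by the factor `χ`, acting in the `y`-plane only:
in cylindrical coordinates `(r, φ, z) ↦ (χ r, φ + ψ, z)`. -/
def rotDilY (χ ψ : ℝ) (x : (ℝ × ℝ) × (Fin d → ℝ)) : (ℝ × ℝ) × (Fin d → ℝ) :=
  ((χ * (x.1.1 * Real.cos ψ - x.1.2 * Real.sin ψ),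
    χ * (x.1.1 * Real.sin ψ + x.1.2 * Real.cos ψ)), x.2)

/-- Integral over the half-plane `Γ = γ × ℝ^d`, `γ = {φ = b}`:
`∫_Γ h dΓ = ∫_{ℝ^d} ∫₀^∞ h(r, b, z) dr dz`. -/
def faceInt (b : ℝ) (h : (ℝ × ℝ) × (Fin d → ℝ) → ℂ) : ℂ :=
  ∫ z : Fin d → ℝ, ∫ r in Set.Ioi (0 : ℝ), h ((r * Real.cos b, r * Real.sin b), z)

/-- `W` is smooth on an open neighbourhood of the set `s`
(the formalization of `W ∈ C^∞(s)` for a non-open `s`). -/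
def SmoothNear3 (W : (ℝ × ℝ) × (Fin d → ℝ) → ℂ) (s : Set ((ℝ × ℝ) × (Fin d → ℝ))) : Prop :=
  ∃ O : Set ((ℝ × ℝ) × (Fin d → ℝ)), IsOpen O ∧ s ⊆ O ∧ ContDiffOn ℝ (⊤ : ℕ∞) W O

theorem injOn_polarCoord_symm_Ioi_prod_Ioo {a b : ℝ} (hab : b - a ≤ 2 * π) :
    InjOn polarCoord.symm (Ioi (0 : ℝ) ×ˢ Ioo a b) := by
  rintro ⟨r, θ⟩ ⟨hr, hθ⟩ ⟨s, η⟩ ⟨hs, hη⟩ h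
  simp only [polarCoord_symm_apply, Prod.mk.injEq] at h
  simp only [mem_Ioi, mem_Ioo] at hr hθ hs hη
  obtain ⟨h1, h2⟩ := h
  have hrs : r = s := by
    have hsq : r ^ 2 = s ^ 2 := by
      have e1 : r ^ 2 = (r * cos θ) ^ 2 + (r * sin θ) ^ 2 := by
        linear_combination -(r ^ 2) * cos_sq_add_sin_sq θ
      have e2 : s ^ 2 = (s * cos η) ^ 2 + (s * sin η) ^ 2 := by
        linear_combination -(s ^ 2) * cos_sq_add_sin_sq η
      rw [e1, e2, h1, h2]
    exact (sq_eq_sq₀ hr.le hs.le).1 hsq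
  subst hrs
  have hc : cos θ = cos η := mul_left_cancel₀ hr.ne' h1
  have hsin : sin θ = sin η := mul_left_cancel₀ hr.ne' h2
  have hcos : cos (θ - η) = 1 := by
    rw [cos_sub, hc, hsin]
    linear_combination cos_sq_add_sin_sq η
  have h0 : θ - η = 0 :=
    (cos_eq_one_iff_of_lt_of_lt (by linarith [hθ.1, hη.2]) (by linarith [hθ.2, hη.1])).1 hcos
  rw [sub_eq_zero.1 h0]

theorem sector_eq_image (a b : ℝ) :
    sector a b = polarCoord.symm '' (Ioi (0 : ℝ) ×ˢ Ioo a b) := by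
  ext y
  constructor
  · rintro ⟨r, θ, hr, h1, h2, rfl⟩
    exact ⟨(r, θ), ⟨hr, h1, h2⟩, rfl⟩
  · rintro ⟨⟨r, θ⟩, ⟨hr, h1, h2⟩, rfl⟩
    exact ⟨r, θ, hr, h1, h2, rfl⟩

theorem measurableSet_sector {a b : ℝ} (hab : b - a ≤ 2 * π) : MeasurableSet (sector a b) := by
  rw [sector_eq_image]
  exact measurable_image_of_fderivWithin (measurableSet_Ioi.prod measurableSet_Ioo)
    (fun p _ => (hasFDerivAt_polarCoord_symm p).hasFDerivWithinAt)
    (injOn_polarCoord_symm_Ioi_prod_Ioo hab)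

theorem setIntegral_sector {a b : ℝ} (hab : b - a ≤ 2 * π) (f : ℝ × ℝ → ℂ) :
    ∫ y in sector a b, f y =
      ∫ p in Ioi (0 : ℝ) ×ˢ Ioo a b, p.1 • f (p.1 * cos p.2, p.1 * sin p.2) := by
  have hm : MeasurableSet (Ioi (0 : ℝ) ×ˢ Ioo a b) := measurableSet_Ioi.prod measurableSet_Ioo
  rw [sector_eq_image, integral_image_eq_integral_abs_det_fderiv_smul volume hm
    (fun p _ => (hasFDerivAt_polarCoord_symm p).hasFDerivWithinAt)
    (injOn_polarCoord_symm_Ioi_prod_Ioo hab)]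
  refine setIntegral_congr_fun hm fun p hp => ?_
  simp only [det_fderivPolarCoordSymm, abs_of_pos (show 0 < p.1 from hp.1), polarCoord_symm_apply]

/-- The divergence theorem in a plane sector. -/
theorem setIntegral_sector_divergence {a b : ℝ} (hab : a ≤ b) (hab' : b - a ≤ 2 * π)
    {F G : ℝ × ℝ → ℂ} (hF : ContDiff ℝ 1 F) (hG : ContDiff ℝ 1 G)
    (hFc : HasCompactSupport F) (hGc : HasCompactSupport G) :
    ∫ y in sector a b, (fderiv ℝ F y (1, 0) + fderiv ℝ G y (0, 1)) =
      (∫ r in Ioi (0 : ℝ), (-(sin b : ℂ) * F (r * cos b, r * sin b) +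
        (cos b : ℂ) * G (r * cos b, r * sin b))) -
      ∫ r in Ioi (0 : ℝ), (-(sin a : ℂ) * F (r * cos a, r * sin a) +
        (cos a : ℂ) * G (r * cos a, r * sin a)) := by
  obtain ⟨R, hR0, hR⟩ : ∃ R : ℝ, 0 < R ∧ ∀ r θ : ℝ, R ≤ r →
      (r * cos θ, r * sin θ) ∉ tsupport F ∪ tsupport G := by
    obtain ⟨C, hC⟩ := (hFc.isCompact.union hGc.isCompact).isBounded.exists_norm_le
    refine ⟨2 * |C| + 1, by positivity, fun r θ hr hmem => ?_⟩
    have h := hC _ hmem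
    have h1 : |r * cos θ| ≤ C := (norm_fst_le (r * cos θ, r * sin θ)).trans h
    have h2 : |r * sin θ| ≤ C := (norm_snd_le (r * cos θ, r * sin θ)).trans h
    have hC0 : 0 ≤ C := (abs_nonneg _).trans h1
    rw [abs_of_nonneg hC0] at hr
    have e : r ^ 2 = (r * cos θ) ^ 2 + (r * sin θ) ^ 2 := by
      linear_combination -(r ^ 2) * cos_sq_add_sin_sq θ
    have h1' := sq_le_sq' (abs_le.1 h1).1 (abs_le.1 h1).2
    have h2' := sq_le_sq' (abs_le.1 h2).1 (abs_le.1 h2).2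
    nlinarith
  have hF0 : ∀ r θ : ℝ, R ≤ r → F (r * cos θ, r * sin θ) = 0 := fun r θ h =>
    image_eq_zero_of_notMem_tsupport fun h' => hR r θ h (Or.inl h')
  have hG0 : ∀ r θ : ℝ, R ≤ r → G (r * cos θ, r * sin θ) = 0 := fun r θ h =>
    image_eq_zero_of_notMem_tsupport fun h' => hR r θ h (Or.inr h')
  have hdF0 : ∀ r θ : ℝ, R ≤ r → fderiv ℝ F (r * cos θ, r * sin θ) = 0 := fun r θ h =>
    image_eq_zero_of_notMem_tsupport fun h' => hR r θ h (Or.inl (tsupport_fderiv_subset ℝ h'))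
  have hdG0 : ∀ r θ : ℝ, R ≤ r → fderiv ℝ G (r * cos θ, r * sin θ) = 0 := fun r θ h =>
    image_eq_zero_of_notMem_tsupport fun h' => hR r θ h (Or.inr (tsupport_fderiv_subset ℝ h'))
  set P : ℝ × ℝ → ℂ := fun p => (p.1 : ℂ) * ((cos p.2 : ℂ) * F (p.1 * cos p.2, p.1 * sin p.2) +
    (sin p.2 : ℂ) * G (p.1 * cos p.2, p.1 * sin p.2)) with hP
  set Q : ℝ × ℝ → ℂ := fun p => -(sin p.2 : ℂ) * F (p.1 * cos p.2, p.1 * sin p.2) +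
    (cos p.2 : ℂ) * G (p.1 * cos p.2, p.1 * sin p.2) with hQ
  have hpol : ContDiff ℝ 1 (fun p : ℝ × ℝ => (p.1 * cos p.2, p.1 * sin p.2)) :=
    (contDiff_fst.mul (contDiff_cos.comp contDiff_snd)).prodMk
      (contDiff_fst.mul (contDiff_sin.comp contDiff_snd))
  have hFp : ContDiff ℝ 1 (fun p : ℝ × ℝ => F (p.1 * cos p.2, p.1 * sin p.2)) := hF.comp hpol
  have hGp : ContDiff ℝ 1 (fun p : ℝ × ℝ => G (p.1 * cos p.2, p.1 * sin p.2)) := hG.comp hpol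
  have hfst : ContDiff ℝ 1 (fun p : ℝ × ℝ => (p.1 : ℂ)) :=
    Complex.ofRealCLM.contDiff.comp contDiff_fst
  have hcos : ContDiff ℝ 1 (fun p : ℝ × ℝ => ((cos p.2 : ℝ) : ℂ)) :=
    Complex.ofRealCLM.contDiff.comp (contDiff_cos.comp contDiff_snd)
  have hsin : ContDiff ℝ 1 (fun p : ℝ × ℝ => ((sin p.2 : ℝ) : ℂ)) :=
    Complex.ofRealCLM.contDiff.comp (contDiff_sin.comp contDiff_snd)
  have hPd : ContDiff ℝ 1 P := hfst.mul ((hcos.mul hFp).add (hsin.mul hGp))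
  have hQd : ContDiff ℝ 1 Q := (hsin.neg.mul hFp).add (hcos.mul hGp)
  have key : ∀ p : ℝ × ℝ, fderiv ℝ P p (1, 0) + fderiv ℝ Q p (0, 1) =
      p.1 • (fderiv ℝ F (p.1 * cos p.2, p.1 * sin p.2) (1, 0) +
        fderiv ℝ G (p.1 * cos p.2, p.1 * sin p.2) (0, 1)) := by
    rintro ⟨r, θ⟩
    have dcos : HasDerivAt (fun t : ℝ => ((cos t : ℝ) : ℂ)) ((-sin θ : ℝ) : ℂ) θ :=
      (hasDerivAt_cos θ).ofReal_comp
    have dsin : HasDerivAt (fun t : ℝ => ((sin t : ℝ) : ℂ)) ((cos θ : ℝ) : ℂ) θ :=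
      (hasDerivAt_sin θ).ofReal_comp
    have lin : ∀ (A : ℝ × ℝ →L[ℝ] ℂ) (x y : ℝ), A (x, y) = x * A (1, 0) + y * A (0, 1) := by
      intro A x y
      have : ((x, y) : ℝ × ℝ) = x • (1, 0) + y • (0, 1) := by simp
      rw [this, map_add, map_smul, map_smul, Complex.real_smul, Complex.real_smul]
    have curve_r : HasDerivAt (fun t : ℝ => (t * cos θ, t * sin θ)) (cos θ, sin θ) r := by
      simpa using ((hasDerivAt_id r).mul_const (cos θ)).prodMk
        ((hasDerivAt_id r).mul_const (sin θ))
    have curve_θ : HasDerivAt (fun t : ℝ => (r * cos t, r * sin t)) (r * -sin θ, r * cos θ) θ :=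
      ((hasDerivAt_cos θ).const_mul r).prodMk ((hasDerivAt_sin θ).const_mul r)
    have comp_r : ∀ {H : ℝ × ℝ → ℂ}, ContDiff ℝ 1 H →
        HasDerivAt (fun t : ℝ => H (t * cos θ, t * sin θ))
          (fderiv ℝ H (r * cos θ, r * sin θ) (cos θ, sin θ)) r := fun {H} hH =>
      ((hH.differentiable one_ne_zero) _).hasFDerivAt.comp_hasDerivAt r curve_r
    have comp_θ : ∀ {H : ℝ × ℝ → ℂ}, ContDiff ℝ 1 H →
        HasDerivAt (fun t : ℝ => H (r * cos t, r * sin t))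
          (fderiv ℝ H (r * cos θ, r * sin θ) (r * -sin θ, r * cos θ)) θ := fun {H} hH =>
      ((hH.differentiable one_ne_zero) _).hasFDerivAt.comp_hasDerivAt θ curve_θ
    have d_id : HasDerivAt (fun t : ℝ => (t : ℂ)) 1 r := (hasDerivAt_id r).ofReal_comp
    have lineP : HasDerivAt (fun t : ℝ => P (t, θ)) (fderiv ℝ P (r, θ) (1, 0)) r :=
      ((hPd.differentiable one_ne_zero) _).hasFDerivAt.comp_hasDerivAt r
        ((hasDerivAt_id r).prodMk (hasDerivAt_const r θ))
    have lineQ : HasDerivAt (fun t : ℝ => Q (r, t)) (fderiv ℝ Q (r, θ) (0, 1)) θ :=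
      ((hQd.differentiable one_ne_zero) _).hasFDerivAt.comp_hasDerivAt θ
        ((hasDerivAt_const θ r).prodMk (hasDerivAt_id θ))
    have e1 := lineP.unique (d_id.mul (((comp_r hF).const_mul (cos θ : ℂ)).add
      ((comp_r hG).const_mul (sin θ : ℂ))))
    have e2 := lineQ.unique ((dsin.neg.mul (comp_θ hF)).add (dcos.mul (comp_θ hG)))
    rw [e1, e2]
    simp only [lin _ (cos θ) (sin θ), lin _ (r * -sin θ) (r * cos θ), Complex.real_smul]
    have hcs : (cos θ : ℂ) ^ 2 + (sin θ : ℂ) ^ 2 = 1 := by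
      exact_mod_cast cos_sq_add_sin_sq θ
    simp only [Complex.ofReal_mul, Complex.ofReal_neg, Pi.neg_apply]
    linear_combination (r * fderiv ℝ F (r * cos θ, r * sin θ) (1, 0) +
      r * fderiv ℝ G (r * cos θ, r * sin θ) (0, 1)) * hcs
  have hdiv := integral_divergence_prod_Icc_of_hasFDerivAt_of_le P Q (fderiv ℝ P) (fderiv ℝ Q)
    (0, a) (R, b) ⟨hR0.le, hab⟩ hPd.continuous.continuousOn hQd.continuous.continuousOn
    (fun x _ => ((hPd.differentiable one_ne_zero) x).hasFDerivAt)
    (fun x _ => ((hQd.differentiable one_ne_zero) x).hasFDerivAt)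
    ((((hPd.continuous_fderiv one_ne_zero).clm_apply continuous_const).add
      ((hQd.continuous_fderiv one_ne_zero).clm_apply continuous_const)).continuousOn.integrableOn_compact
        isCompact_Icc)
  have hIoi : ∀ θ : ℝ, ∫ r in (0 : ℝ)..R, Q (r, θ) = ∫ r in Ioi (0 : ℝ), Q (r, θ) := by
    intro θ
    rw [intervalIntegral.integral_of_le hR0.le]
    refine (setIntegral_eq_of_subset_of_forall_sdiff_eq_zero measurableSet_Ioi
      (fun x hx => hx.1) fun r hr => ?_).symm
    have hr' : R ≤ r := by
      by_contra! h
      exact hr.2 ⟨hr.1, h.le⟩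
    simp [hQ, hF0 r θ hr', hG0 r θ hr']
  have hP0 : ∀ θ, P (0, θ) = 0 := fun θ => by simp [hP]
  have hPR : ∀ θ, P (R, θ) = 0 := fun θ => by simp [hP, hF0 R θ le_rfl, hG0 R θ le_rfl]
  simp only [hP0, hPR, intervalIntegral.integral_zero, add_zero, sub_zero, hIoi, key] at hdiv
  rw [setIntegral_sector hab', ← hdiv, Icc_prod_eq]
  have hae : (Ioc (0 : ℝ) R ×ˢ Ioo a b : Set (ℝ × ℝ)) =ᵐ[volume]
      (Icc 0 R ×ˢ Icc a b : Set (ℝ × ℝ)) :=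
    Measure.set_prod_ae_eq Ioc_ae_eq_Icc Ioo_ae_eq_Icc
  rw [← setIntegral_congr_set hae]
  refine setIntegral_eq_of_subset_of_forall_sdiff_eq_zero
    (measurableSet_Ioi.prod measurableSet_Ioo) (prod_mono (fun x hx => hx.1) subset_rfl)
    fun p hp => ?_
  have hr' : R ≤ p.1 := by
    by_contra! h
    exact hp.2 ⟨⟨hp.1.1, h.le⟩, hp.1.2⟩
  simp [hdF0 _ _ hr', hdG0 _ _ hr']

theorem integral_fderiv_apply_eq_zero {E : Type*} [NormedAddCommGroup E] [NormedSpace ℝ E]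
    [FiniteDimensional ℝ E] [MeasurableSpace E] [BorelSpace E] {μ : Measure E}
    [μ.IsAddHaarMeasure] {f : E → ℂ} (hf : ContDiff ℝ 1 f) (hfc : HasCompactSupport f) (v : E) :
    ∫ x, fderiv ℝ f x v ∂μ = 0 := by
  have hi : Integrable f μ := hf.continuous.integrable_of_hasCompactSupport hfc
  have hi' : Integrable (fun x => fderiv ℝ f x v) μ :=
    ((hf.continuous_fderiv one_ne_zero).clm_apply continuous_const).integrable_of_hasCompactSupport
      (hfc.fderiv_apply ℝ v)
  have h := integral_bilinear_hasLineDerivAt_right_eq_neg_left_of_integrable (μ := μ)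
    (f := fun _ : E => (1 : ℂ)) (f' := fun _ => (0 : ℂ)) (g := f) (g' := fun x => fderiv ℝ f x v)
    (v := v) (B := ContinuousLinearMap.mul ℝ ℂ) (by simp) (by simpa using hi') (by simpa using hi)
    (fun x _ => (hasFDerivAt_const (1 : ℂ) x).hasLineDerivAt v)
    (fun x _ => ((hf.differentiable one_ne_zero) x).hasFDerivAt.hasLineDerivAt v)
  simpa using h

section Dihedral

variable {d}

/-- Parametrization of the plane containing the face `φ = b` by `z` and the signed radius. -/
def facePoint (b : ℝ) (p : (Fin d → ℝ) × ℝ) : (ℝ × ℝ) × (Fin d → ℝ) :=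
  ((p.2 * cos b, p.2 * sin b), p.1)

theorem continuous_facePoint (b : ℝ) : Continuous (facePoint (d := d) b) := by
  unfold facePoint
  fun_prop

/-- Integrability over the face `φ = b`. -/
def FaceIntegrable (b : ℝ) (h : (ℝ × ℝ) × (Fin d → ℝ) → ℂ) : Prop :=
  Integrable (fun p => h (facePoint b p)) ((volume : Measure (Fin d → ℝ)).prod
    (volume.restrict (Ioi (0 : ℝ))))

theorem faceIntegrable_of_isCompact {b : ℝ} {h : (ℝ × ℝ) × (Fin d → ℝ) → ℂ}
    {K : Set ((ℝ × ℝ) × (Fin d → ℝ))} (hK : IsCompact K) (h0 : ∀ x ∉ K, h x = 0)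
    (hc : ContinuousOn h (K ∩ facePoint b '' {p | 0 ≤ p.2})) : FaceIntegrable b h := by
  set S : Set ((Fin d → ℝ) × ℝ) := facePoint b ⁻¹' K ∩ {p | 0 ≤ p.2} with hS
  have hSc : IsCompact S := by
    have hcont : Continuous (fun x : (ℝ × ℝ) × (Fin d → ℝ) =>
        (x.2, x.1.1 * cos b + x.1.2 * sin b)) := by fun_prop
    refine (hK.image hcont).of_isClosed_subset
      ((hK.isClosed.preimage (continuous_facePoint b)).inter
        (isClosed_le continuous_const continuous_snd)) fun p hp => ⟨facePoint b p, hp.1, ?_⟩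
    refine Prod.ext rfl ?_
    simp only [facePoint]
    linear_combination p.2 * cos_sq_add_sin_sq b
  have hcS : ContinuousOn (fun p => h (facePoint b p)) S :=
    hc.comp (continuous_facePoint b).continuousOn fun p hp => ⟨hp.1, p, hp.2, rfl⟩
  have hi : IntegrableOn (fun p => h (facePoint b p)) S := hcS.integrableOn_compact hSc
  have hi' : IntegrableOn (fun p => h (facePoint b p)) (univ ×ˢ Ioi (0 : ℝ)) :=
    hi.of_forall_sdiff_eq_zero (MeasurableSet.univ.prod measurableSet_Ioi) fun p hp =>
      h0 _ fun hpK => hp.2 ⟨hpK, le_of_lt (mem_Ioi.1 hp.1.2)⟩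
  rwa [IntegrableOn, Measure.volume_eq_prod, ← Measure.prod_restrict, Measure.restrict_univ] at hi'

theorem Continuous.faceIntegrable {h : (ℝ × ℝ) × (Fin d → ℝ) → ℂ} (hc : Continuous h)
    (hs : HasCompactSupport h) (b : ℝ) : FaceIntegrable b h :=
  faceIntegrable_of_isCompact hs (fun _ hx => image_eq_zero_of_notMem_tsupport hx) hc.continuousOn

theorem faceInt_eq_integral_prod {b : ℝ} {h : (ℝ × ℝ) × (Fin d → ℝ) → ℂ}
    (hh : FaceIntegrable b h) :
    faceInt d b h = ∫ p, h (facePoint b p) ∂((volume : Measure (Fin d → ℝ)).prod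
      (volume.restrict (Ioi (0 : ℝ)))) :=
  (integral_prod _ hh).symm

theorem faceInt_add {b : ℝ} {f g : (ℝ × ℝ) × (Fin d → ℝ) → ℂ}
    (hf : FaceIntegrable b f) (hg : FaceIntegrable b g) :
    faceInt d b (fun x => f x + g x) = faceInt d b f + faceInt d b g := by
  rw [faceInt_eq_integral_prod hf, faceInt_eq_integral_prod hg, ← integral_add hf hg]
  exact faceInt_eq_integral_prod (h := fun x => f x + g x) (hf.add hg)

theorem faceInt_sub {b : ℝ} {f g : (ℝ × ℝ) × (Fin d → ℝ) → ℂ}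
    (hf : FaceIntegrable b f) (hg : FaceIntegrable b g) :
    faceInt d b (fun x => f x - g x) = faceInt d b f - faceInt d b g := by
  rw [faceInt_eq_integral_prod hf, faceInt_eq_integral_prod hg, ← integral_sub hf hg]
  exact faceInt_eq_integral_prod (h := fun x => f x - g x) (hf.sub hg)

theorem faceInt_const_mul (b : ℝ) (c : ℂ) (f : (ℝ × ℝ) × (Fin d → ℝ) → ℂ) :
    faceInt d b (fun x => c * f x) = c * faceInt d b f := by
  simp only [faceInt, integral_const_mul]

theorem faceInt_congr {b : ℝ} {f g : (ℝ × ℝ) × (Fin d → ℝ) → ℂ}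
    (h : ∀ z r, 0 < r → f (facePoint b (z, r)) = g (facePoint b (z, r))) :
    faceInt d b f = faceInt d b g :=
  integral_congr_ae (.of_forall fun z => setIntegral_congr_fun measurableSet_Ioi fun r hr => h z r hr)

theorem measurableSet_dihedral {a b : ℝ} (hab : b - a ≤ 2 * π) :
    MeasurableSet (dihedral d a b) :=
  (measurableSet_sector hab).prod MeasurableSet.univ

theorem dd3_contDiff {W : (ℝ × ℝ) × (Fin d → ℝ) → ℂ} (hW : ContDiff ℝ (⊤ : ℕ∞) W)
    (v : (ℝ × ℝ) × (Fin d → ℝ)) : ContDiff ℝ (⊤ : ℕ∞) (dd3 d W v) :=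
  (hW.fderiv_right (by simp)).clm_apply contDiff_const

theorem dd3_hasCompactSupport {W : (ℝ × ℝ) × (Fin d → ℝ) → ℂ} (hW : HasCompactSupport W)
    (v : (ℝ × ℝ) × (Fin d → ℝ)) : HasCompactSupport (dd3 d W v) :=
  hW.fderiv_apply ℝ v

theorem lap3_continuous {W : (ℝ × ℝ) × (Fin d → ℝ) → ℂ} (hW : ContDiff ℝ (⊤ : ℕ∞) W) :
    Continuous (lap3 d W) := by
  have h v := (dd3_contDiff (dd3_contDiff hW v) v).continuous
  exact ((h _).add (h _)).add (continuous_finsetSum _ fun i _ => h _)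

/-- The divergence theorem in a dihedral angle. -/
theorem setIntegral_dihedral_divergence {a b : ℝ} (hab : a ≤ b) (hab' : b - a ≤ 2 * π)
    {F G : (ℝ × ℝ) × (Fin d → ℝ) → ℂ} {H : Fin d → (ℝ × ℝ) × (Fin d → ℝ) → ℂ}
    (hF : ContDiff ℝ 1 F) (hG : ContDiff ℝ 1 G) (hH : ∀ i, ContDiff ℝ 1 (H i))
    (hFc : HasCompactSupport F) (hGc : HasCompactSupport G) (hHc : ∀ i, HasCompactSupport (H i)) :
    ∫ x in dihedral d a b, (dd3 d F ((1, 0), 0) x + dd3 d G ((0, 1), 0) x +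
        ∑ i, dd3 d (H i) (0, Pi.single i 1) x) =
      faceInt d b (fun x => -(sin b : ℂ) * F x + (cos b : ℂ) * G x) -
        faceInt d a (fun x => -(sin a : ℂ) * F x + (cos a : ℂ) * G x) := by
  have hint : ∀ {W : (ℝ × ℝ) × (Fin d → ℝ) → ℂ} (v : (ℝ × ℝ) × (Fin d → ℝ)), ContDiff ℝ 1 W →
      HasCompactSupport W → Integrable (dd3 d W v) := fun {W} v hW hWc =>
    Continuous.integrable_of_hasCompactSupport
      ((hW.continuous_fderiv one_ne_zero).clm_apply continuous_const)
      (dd3_hasCompactSupport hWc v)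
  have hslice : ∀ {W : (ℝ × ℝ) × (Fin d → ℝ) → ℂ}, ContDiff ℝ 1 W → ∀ y z v w,
      dd3 d W (v, w) (y, z) = fderiv ℝ (fun y' => W (y', z)) y v +
        fderiv ℝ (fun z' => W (y, z')) z w := by
    intro W hW y z v w
    have h := ((hW.differentiable one_ne_zero) (y, z)).hasFDerivAt
    have hy : HasFDerivAt (fun y' => W (y', z)) _ y :=
      HasFDerivAt.comp (g := W) (f := fun y' => (y', z)) y h (hasFDerivAt_prodMk_left y z)
    have hz : HasFDerivAt (fun z' => W (y, z')) _ z :=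
      HasFDerivAt.comp (g := W) (f := fun z' => (y, z')) z h (hasFDerivAt_prodMk_right y z)
    rw [hy.fderiv, hz.fderiv]
    simp only [ContinuousLinearMap.comp_apply, dd3, ContinuousLinearMap.inl_apply,
      ContinuousLinearMap.inr_apply, ← map_add]
    simp
  have hcy : ∀ {W : (ℝ × ℝ) × (Fin d → ℝ) → ℂ}, HasCompactSupport W → ∀ z,
      HasCompactSupport (fun y => W (y, z)) := fun {W} hW z =>
    .intro (hW.isCompact.image continuous_fst) fun y hy =>
      image_eq_zero_of_notMem_tsupport fun hmem => hy ⟨_, hmem, rfl⟩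
  have hcz : ∀ {W : (ℝ × ℝ) × (Fin d → ℝ) → ℂ}, HasCompactSupport W → ∀ y,
      HasCompactSupport (fun z => W (y, z)) := fun {W} hW y =>
    .intro (hW.isCompact.image continuous_snd) fun z hz =>
      image_eq_zero_of_notMem_tsupport fun hmem => hz ⟨_, hmem, rfl⟩
  have hres : (volume : Measure ((ℝ × ℝ) × (Fin d → ℝ))).restrict (dihedral d a b) =
      (volume.restrict (sector a b)).prod volume := by
    rw [dihedral, Measure.volume_eq_prod, ← Measure.prod_restrict, Measure.restrict_univ]
  have hplane : Integrable (fun x => dd3 d F ((1, 0), 0) x + dd3 d G ((0, 1), 0) x) :=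
    (hint _ hF hFc).add (hint _ hG hGc)
  have hedge : ∀ i, ∫ x in dihedral d a b, dd3 d (H i) (0, Pi.single i 1) x = 0 := by
    intro i
    have hi := (hint (0, Pi.single i 1) (hH i) (hHc i)).restrict (s := dihedral d a b)
    rw [hres] at hi ⊢
    rw [integral_prod _ hi]
    refine integral_eq_zero_of_ae (.of_forall fun y => ?_)
    simp only [hslice (hH i), map_zero, zero_add, Pi.zero_apply]
    exact integral_fderiv_apply_eq_zero ((hH i).comp (contDiff_const.prodMk contDiff_id))
      (hcz (hHc i) y) _
  rw [integral_add hplane.restrict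
      (integrable_finsetSum _ fun i _ => (hint _ (hH i) (hHc i)).restrict),
    integral_finsetSum _ fun i _ => (hint _ (hH i) (hHc i)).restrict]
  simp only [hedge, Finset.sum_const_zero, add_zero]
  have hi := hplane.restrict (s := dihedral d a b)
  have hface : ∀ θ, FaceIntegrable θ (fun x => -(sin θ : ℂ) * F x + (cos θ : ℂ) * G x) :=
    fun θ => Continuous.faceIntegrable
      ((continuous_const.mul hF.continuous).add (continuous_const.mul hG.continuous))
      (hFc.mul_left.add hGc.mul_left) θ
  rw [hres] at hi ⊢
  rw [integral_prod_symm _ hi]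
  have hradial : ∀ θ, Integrable (fun z : Fin d → ℝ => ∫ r in Ioi (0 : ℝ),
      (-(sin θ : ℂ) * F ((r * cos θ, r * sin θ), z) +
        (cos θ : ℂ) * G ((r * cos θ, r * sin θ), z))) := fun θ => (hface θ).integral_prod_left
  simp only [faceInt]
  rw [← integral_sub (hradial b) (hradial a)]
  refine integral_congr_ae (.of_forall fun z => ?_)
  simp only [hslice hF, hslice hG, map_zero, add_zero]
  exact setIntegral_sector_divergence hab hab' (hF.comp (contDiff_id.prodMk contDiff_const))
    (hG.comp (contDiff_id.prodMk contDiff_const)) (hcy hFc z) (hcy hGc z)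

theorem dd3_normal (W : (ℝ × ℝ) × (Fin d → ℝ) → ℂ) (b : ℝ) (x : (ℝ × ℝ) × (Fin d → ℝ)) :
    dd3 d W ((-sin b, cos b), 0) x =
      -(sin b : ℂ) * dd3 d W ((1, 0), 0) x + (cos b : ℂ) * dd3 d W ((0, 1), 0) x := by
  have : (((-sin b, cos b), 0) : (ℝ × ℝ) × (Fin d → ℝ)) =
      (-sin b) • ((1, 0), 0) + (cos b) • ((0, 1), 0) := by simp
  simp only [dd3]
  rw [this, map_add, map_smul, map_smul, Complex.real_smul, Complex.real_smul,
    Complex.ofReal_neg]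

/-- Green's formula in a dihedral angle for smooth functions with compact support. -/
theorem green_formula_dihedral_of_contDiff {a b : ℝ} (hab : a ≤ b) (hab' : b - a ≤ 2 * π)
    {u w : (ℝ × ℝ) × (Fin d → ℝ) → ℂ}
    (hu : ContDiff ℝ (⊤ : ℕ∞) u) (hw : ContDiff ℝ (⊤ : ℕ∞) w) (huc : HasCompactSupport u) :
    (∫ x in dihedral d a b, lap3 d u x * w x) - ∫ x in dihedral d a b, u x * lap3 d w x =
      (faceInt d b (fun x => dd3 d u ((-sin b, cos b), 0) x * w x) -
        faceInt d b (fun x => u x * dd3 d w ((-sin b, cos b), 0) x)) -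
      (faceInt d a (fun x => dd3 d u ((-sin a, cos a), 0) x * w x) -
        faceInt d a (fun x => u x * dd3 d w ((-sin a, cos a), 0) x)) := by
  set X : (ℝ × ℝ) × (Fin d → ℝ) → (ℝ × ℝ) × (Fin d → ℝ) → ℂ :=
    fun v x => dd3 d u v x * w x - u x * dd3 d w v x with hX
  have h1 : (1 : WithTop ℕ∞) ≤ ((⊤ : ℕ∞) : WithTop ℕ∞) := by exact_mod_cast le_top
  have hXd : ∀ v, ContDiff ℝ 1 (X v) := fun v =>
    (((dd3_contDiff hu v).mul hw).sub (hu.mul (dd3_contDiff hw v))).of_le h1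
  have hXc : ∀ v, HasCompactSupport (X v) := fun v =>
    .intro huc.isCompact fun x hx => by
      have h0 : dd3 d u v x = 0 :=
        image_eq_zero_of_notMem_tsupport fun h => hx (tsupport_fderiv_apply_subset ℝ v h)
      simp [hX, h0, image_eq_zero_of_notMem_tsupport hx]
  have hXX : ∀ v x, dd3 d (X v) v x = dd3 d (dd3 d u v) v x * w x - u x * dd3 d (dd3 d w v) v x := by
    intro v x
    have hd : ∀ {f : (ℝ × ℝ) × (Fin d → ℝ) → ℂ}, ContDiff ℝ (⊤ : ℕ∞) f →
        HasFDerivAt f (fderiv ℝ f x) x := fun hf =>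
      ((hf.differentiable (by simp)) x).hasFDerivAt
    have h := ((hd (dd3_contDiff hu v)).mul (hd hw)).sub ((hd hu).mul (hd (dd3_contDiff hw v)))
    have h' : dd3 d (X v) v x = _ := congrArg (fun L => L v) h.fderiv
    rw [h']
    simp only [dd3, sub_apply, add_apply, smul_apply, smul_eq_mul]
    ring
  have hdiv := setIntegral_dihedral_divergence hab hab' (hXd ((1, 0), 0)) (hXd ((0, 1), 0))
    (fun i => hXd (0, Pi.single i 1)) (hXc _) (hXc _) (fun i => hXc _)
  have hlap : ∀ x, dd3 d (X ((1, 0), 0)) ((1, 0), 0) x + dd3 d (X ((0, 1), 0)) ((0, 1), 0) x +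
      ∑ i, dd3 d (X (0, Pi.single i 1)) (0, Pi.single i 1) x =
      lap3 d u x * w x - u x * lap3 d w x := by
    intro x
    simp only [hXX, lap3, Finset.sum_sub_distrib, ← Finset.sum_mul, ← Finset.mul_sum]
    ring
  have hnormal : ∀ θ x, -(sin θ : ℂ) * X ((1, 0), 0) x + (cos θ : ℂ) * X ((0, 1), 0) x =
      dd3 d u ((-sin θ, cos θ), 0) x * w x - u x * dd3 d w ((-sin θ, cos θ), 0) x := by
    intro θ x
    simp only [hX, dd3_normal]
    ring
  have hlapc : HasCompactSupport (lap3 d u) := by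
    refine .intro huc.isCompact fun x hx => ?_
    have hz : ∀ v, dd3 d (dd3 d u v) v x = 0 := fun v =>
      image_eq_zero_of_notMem_tsupport fun h => hx
        (tsupport_fderiv_apply_subset ℝ v (tsupport_fderiv_apply_subset ℝ v h))
    simp [lap3, hz]
  simp only [hlap, hnormal] at hdiv
  have hiu : Integrable (fun x => lap3 d u x * w x) :=
    ((lap3_continuous hu).mul hw.continuous).integrable_of_hasCompactSupport hlapc.mul_right
  have hiw : Integrable (fun x => u x * lap3 d w x) :=
    (hu.continuous.mul (lap3_continuous hw)).integrable_of_hasCompactSupport huc.mul_right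
  rw [integral_sub hiu.restrict hiw.restrict] at hdiv
  have hfu : ∀ θ, FaceIntegrable θ (fun x => dd3 d u ((-sin θ, cos θ), 0) x * w x) := fun θ =>
    Continuous.faceIntegrable ((dd3_contDiff hu _).continuous.mul hw.continuous)
      (dd3_hasCompactSupport huc _).mul_right θ
  have hfw : ∀ θ, FaceIntegrable θ (fun x => u x * dd3 d w ((-sin θ, cos θ), 0) x) := fun θ =>
    Continuous.faceIntegrable (hu.continuous.mul (dd3_contDiff hw _).continuous)
      huc.mul_right θ
  rw [hdiv, faceInt_sub (hfu b) (hfw b), faceInt_sub (hfu a) (hfw a)]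

theorem facePoint_mem_edge_iff {b : ℝ} {p : (Fin d → ℝ) × ℝ} :
    facePoint b p ∈ edge d ↔ p.2 = 0 := by
  simp only [facePoint, edge, mem_prod, mem_singleton_iff, mem_univ, and_true]
  constructor
  · intro h
    have h1 : p.2 * cos b = 0 := congrArg Prod.fst h
    have h2 : p.2 * sin b = 0 := congrArg Prod.snd h
    linear_combination cos b * h1 + sin b * h2 - p.2 * cos_sq_add_sin_sq b
  · intro h
    simp [h]

theorem facePoint_mem_closure_dihedral {a b θ r : ℝ} (hab : a < b) (hθ : θ ∈ Icc a b)
    (z : Fin d → ℝ) (hr : 0 < r) :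
    facePoint θ (z, r) ∈ closure (dihedral d a b) \ edge d := by
  refine ⟨?_, fun h => hr.ne' (facePoint_mem_edge_iff.1 h)⟩
  have hcont : Continuous (fun t => facePoint t (z, r)) := by
    unfold facePoint
    fun_prop
  rw [← closure_Ioo hab.ne] at hθ
  exact map_mem_closure (f := fun t => facePoint t (z, r)) hcont hθ fun t ht =>
    ⟨⟨r, t, hr, ht.1, ht.2, rfl⟩, mem_univ _⟩

theorem image_facePoint_subset {a b θ : ℝ} (hab : a < b) (hθ : θ ∈ Icc a b) :
    facePoint (d := d) θ '' {p | 0 < p.2} ⊆ closure (dihedral d a b) \ edge d := by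
  rintro _ ⟨⟨z, r⟩, hr, rfl⟩
  exact facePoint_mem_closure_dihedral hab hθ z hr

theorem dihedral_subset_closure_diff_edge (a b : ℝ) :
    dihedral d a b ⊆ closure (dihedral d a b) \ edge d := by
  rintro ⟨y, z⟩ h
  obtain ⟨⟨r, θ, hr, -, -, rfl⟩, -⟩ := id h
  exact ⟨subset_closure h, fun he => hr.ne' (facePoint_mem_edge_iff (p := (z, r)).1 he)⟩

theorem dihedral_mono {a a' b b' : ℝ} (ha : a' ≤ a) (hb : b ≤ b') :
    dihedral d a b ⊆ dihedral d a' b' := by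
  rintro ⟨y, z⟩ ⟨⟨r, θ, hr, h1, h2, rfl⟩, hz⟩
  exact ⟨⟨r, θ, hr, ha.trans_lt h1, h2.trans_le hb, rfl⟩, hz⟩

/-- A function that is continuous on a face and vanishes outside a compact set disjoint from the
edge is integrable over the face. -/
theorem faceIntegrable_of_disjoint_edge {b : ℝ} {h : (ℝ × ℝ) × (Fin d → ℝ) → ℂ}
    {K : Set ((ℝ × ℝ) × (Fin d → ℝ))} (hK : IsCompact K) (hKe : Disjoint K (edge d))
    (h0 : ∀ x ∉ K, h x = 0) (hc : ContinuousOn h (facePoint b '' {p | 0 < p.2})) :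
    FaceIntegrable b h := by
  refine faceIntegrable_of_isCompact hK h0 (hc.mono ?_)
  rintro _ ⟨hpK, p, hp, rfl⟩
  have hp' : 0 ≤ p.2 := hp
  have hp0 : 0 < p.2 := lt_of_le_of_ne hp' fun h =>
    hKe.le_bot ⟨hpK, facePoint_mem_edge_iff.2 h.symm⟩
  exact ⟨p, hp0, rfl⟩

theorem SmoothNear3.mono {W : (ℝ × ℝ) × (Fin d → ℝ) → ℂ} {s t : Set ((ℝ × ℝ) × (Fin d → ℝ))}
    (hW : SmoothNear3 d W t) (hst : s ⊆ t) : SmoothNear3 d W s := by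
  obtain ⟨O, hO, hs, hd⟩ := hW
  exact ⟨O, hO, hst.trans hs, hd⟩

theorem SmoothNear3.continuousOn {W : (ℝ × ℝ) × (Fin d → ℝ) → ℂ}
    {s : Set ((ℝ × ℝ) × (Fin d → ℝ))} (hW : SmoothNear3 d W s) : ContinuousOn W s := by
  obtain ⟨O, hO, hs, hd⟩ := hW
  exact hd.continuousOn.mono hs

theorem SmoothNear3.continuousOn_dd3 {W : (ℝ × ℝ) × (Fin d → ℝ) → ℂ}
    {s : Set ((ℝ × ℝ) × (Fin d → ℝ))} (hW : SmoothNear3 d W s) (v : (ℝ × ℝ) × (Fin d → ℝ)) :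
    ContinuousOn (dd3 d W v) s := by
  obtain ⟨O, hO, hs, hd⟩ := hW
  exact ((hd.continuousOn_fderiv_of_isOpen hO (by exact_mod_cast le_top)).mono hs).clm_apply
    continuousOn_const

/-- A function smooth near a compact set becomes globally smooth with compact support after
multiplication by a cutoff function equal to `1` near that set. -/
theorem SmoothNear3.exists_cutoff {W : (ℝ × ℝ) × (Fin d → ℝ) → ℂ}
    {K : Set ((ℝ × ℝ) × (Fin d → ℝ))} (hW : SmoothNear3 d W K) (hK : IsCompact K) :
    ∃ ψ : (ℝ × ℝ) × (Fin d → ℝ) → ℝ, HasCompactSupport ψ ∧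
      ContDiff ℝ (⊤ : ℕ∞) (fun x => ψ x • W x) ∧ ∀ x ∈ K, ∀ᶠ y in nhds x, ψ y = 1 := by
  obtain ⟨O, hO, hKO, hd⟩ := hW
  obtain ⟨L, hL, hKL, hLO⟩ := exists_compact_between hK hO hKO
  obtain ⟨ψ, h1, h0, -⟩ := exists_contMDiffMap_one_nhds_of_subset_interior (n := (⊤ : ℕ∞))
    (modelWithCornersSelf ℝ ((ℝ × ℝ) × (Fin d → ℝ))) hK.isClosed hKL
  have hψ : ContDiff ℝ (⊤ : ℕ∞) ψ := ψ.contMDiff.contDiff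
  refine ⟨ψ, .intro hL fun x hx => h0 x hx, contDiff_iff_contDiffAt.2 fun x => ?_, fun x hx =>
    eventually_nhdsSet_iff_forall.1 h1 x hx⟩
  by_cases hx : x ∈ O
  · exact hψ.contDiffAt.smul (hd.contDiffAt (hO.mem_nhds hx))
  · have hxL : x ∈ Lᶜ := fun h => hx (hLO h)
    refine (contDiffAt_const (c := (0 : ℂ))).congr_of_eventuallyEq ?_
    filter_upwards [hL.isClosed.isOpen_compl.mem_nhds hxL] with y hy
    rw [h0 y hy, zero_smul]

theorem dd3_eventuallyEq {W W' : (ℝ × ℝ) × (Fin d → ℝ) → ℂ} {x : (ℝ × ℝ) × (Fin d → ℝ)}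
    (h : W =ᶠ[nhds x] W') (v : (ℝ × ℝ) × (Fin d → ℝ)) : dd3 d W v =ᶠ[nhds x] dd3 d W' v :=
  h.fderiv.fun_comp fun L => L v

theorem lap3_congr {W W' : (ℝ × ℝ) × (Fin d → ℝ) → ℂ} {x : (ℝ × ℝ) × (Fin d → ℝ)}
    (h : W =ᶠ[nhds x] W') : lap3 d W x = lap3 d W' x := by
  have hv v : dd3 d (dd3 d W v) v x = dd3 d (dd3 d W' v) v x :=
    (dd3_eventuallyEq (dd3_eventuallyEq h v) v).eq_of_nhds
  simp only [lap3, hv]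

theorem dd3_const (c : ℂ) (v x : (ℝ × ℝ) × (Fin d → ℝ)) : dd3 d (fun _ => c) v x = 0 := by
  simp [dd3]

theorem lap3_const (c : ℂ) (x : (ℝ × ℝ) × (Fin d → ℝ)) : lap3 d (fun _ => c) x = 0 := by
  have h v : dd3 d (fun _ => c) v = fun _ => (0 : ℂ) := funext fun x => dd3_const c v x
  simp [lap3, h, dd3_const]

theorem dd3_conj (W : (ℝ × ℝ) × (Fin d → ℝ) → ℂ) (v : (ℝ × ℝ) × (Fin d → ℝ)) :
    dd3 d (fun x => conj (W x)) v = fun x => conj (dd3 d W v x) := by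
  ext x
  have h : fderiv ℝ (fun x => conj (W x)) x = (Complex.conjCLE : ℂ →L[ℝ] ℂ) ∘L fderiv ℝ W x :=
    Complex.conjCLE.comp_fderiv
  simp [dd3, h]

theorem lap3_conj (W : (ℝ × ℝ) × (Fin d → ℝ) → ℂ) (x : (ℝ × ℝ) × (Fin d → ℝ)) :
    lap3 d (fun x => conj (W x)) x = conj (lap3 d W x) := by
  simp only [lap3, dd3_conj, map_add, map_sum]

/-- Green's formula in a dihedral angle for `-Δ`. -/
theorem green_formula_dihedral {a b : ℝ} (hab : a < b) (hab' : b - a ≤ 2 * π)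
    {U V : (ℝ × ℝ) × (Fin d → ℝ) → ℂ}
    (hU : SmoothNear3 d U (closure (dihedral d a b) \ edge d))
    (hUc : HasCompactSupport U) (hU0 : Disjoint (tsupport U) (edge d))
    (hV : SmoothNear3 d V (closure (dihedral d a b) \ edge d)) :
    (∫ x in dihedral d a b, (-(lap3 d U x)) * conj (V x)) +
        faceInt d a (fun x => U x * conj (dd3 d V ((-sin a, cos a), 0) x)) +
        faceInt d b (fun x => dd3 d U ((-sin b, cos b), 0) x * conj (V x)) =
      (∫ x in dihedral d a b, U x * conj (-(lap3 d V x))) +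
        faceInt d a (fun x => dd3 d U ((-sin a, cos a), 0) x * conj (V x)) +
        faceInt d b (fun x => U x * conj (dd3 d V ((-sin b, cos b), 0) x)) := by
  set C := closure (dihedral d a b) \ edge d
  have hK : IsCompact (tsupport U ∩ closure (dihedral d a b)) :=
    hUc.isCompact.inter_right isClosed_closure
  have hKC : tsupport U ∩ closure (dihedral d a b) ⊆ C := fun x hx =>
    ⟨hx.2, fun he => hU0.le_bot ⟨hx.1, he⟩⟩
  obtain ⟨ψ, hψc, hu, hψ1⟩ := (hU.mono hKC).exists_cutoff hK
  obtain ⟨η, -, hv, hη1⟩ := (hV.mono hKC).exists_cutoff hK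
  set u : (ℝ × ℝ) × (Fin d → ℝ) → ℂ := fun x => ψ x • U x with hu_def
  set v : (ℝ × ℝ) × (Fin d → ℝ) → ℂ := fun x => η x • V x with hv_def
  have hu_near : ∀ x ∈ C, U =ᶠ[nhds x] u ∧ (V =ᶠ[nhds x] v ∨ U =ᶠ[nhds x] fun _ => 0) := by
    intro x hx
    by_cases hxT : x ∈ tsupport U
    · refine ⟨?_, Or.inl ?_⟩
      · filter_upwards [hψ1 x ⟨hxT, hx.1⟩] with y hy
        simp [hu_def, hy]
      · filter_upwards [hη1 x ⟨hxT, hx.1⟩] with y hy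
        simp [hv_def, hy]
    · have h0 : U =ᶠ[nhds x] fun _ => 0 := notMem_tsupport_iff_eventuallyEq.1 hxT
      refine ⟨?_, Or.inr h0⟩
      filter_upwards [h0] with y hy
      simp [hu_def, hy]
  have hw : ContDiff ℝ (⊤ : ℕ∞) (fun x => conj (v x)) := Complex.conjCLE.contDiff.comp hv
  have hgreen := green_formula_dihedral_of_contDiff hab.le hab' hu hw hψc.smul_right
  simp only [dd3_conj, lap3_conj] at hgreen
  have t1 : ∀ x ∈ C, lap3 d u x * conj (v x) = lap3 d U x * conj (V x) := by
    intro x hx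
    obtain ⟨h1, h2 | h2⟩ := hu_near x hx
    · rw [lap3_congr h1, h2.eq_of_nhds]
    · rw [← lap3_congr h1, lap3_congr h2, lap3_const, zero_mul, zero_mul]
  have t2 : ∀ x ∈ C, u x * conj (lap3 d v x) = U x * conj (lap3 d V x) := by
    intro x hx
    obtain ⟨h1, h2 | h2⟩ := hu_near x hx
    · rw [h1.eq_of_nhds, lap3_congr h2]
    · rw [← h1.eq_of_nhds, h2.eq_of_nhds, zero_mul, zero_mul]
  have t3 : ∀ n, ∀ x ∈ C, dd3 d u n x * conj (v x) = dd3 d U n x * conj (V x) := by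
    intro n x hx
    obtain ⟨h1, h2 | h2⟩ := hu_near x hx
    · rw [(dd3_eventuallyEq h1 n).eq_of_nhds, h2.eq_of_nhds]
    · rw [← (dd3_eventuallyEq h1 n).eq_of_nhds, (dd3_eventuallyEq h2 n).eq_of_nhds, dd3_const,
        zero_mul, zero_mul]
  have t4 : ∀ n, ∀ x ∈ C, u x * conj (dd3 d v n x) = U x * conj (dd3 d V n x) := by
    intro n x hx
    obtain ⟨h1, h2 | h2⟩ := hu_near x hx
    · rw [h1.eq_of_nhds, (dd3_eventuallyEq h2 n).eq_of_nhds]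
    · rw [← h1.eq_of_nhds, h2.eq_of_nhds, zero_mul, zero_mul]
  have hDC : dihedral d a b ⊆ C := dihedral_subset_closure_diff_edge a b
  have hm := measurableSet_dihedral (d := d) hab'
  have hf3 : ∀ θ ∈ Icc a b, ∀ n, faceInt d θ (fun x => dd3 d u n x * conj (v x)) =
      faceInt d θ (fun x => dd3 d U n x * conj (V x)) := fun θ hθ n =>
    faceInt_congr fun z r hr => t3 n _ (facePoint_mem_closure_dihedral hab hθ z hr)
  have hf4 : ∀ θ ∈ Icc a b, ∀ n, faceInt d θ (fun x => u x * conj (dd3 d v n x)) =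
      faceInt d θ (fun x => U x * conj (dd3 d V n x)) := fun θ hθ n =>
    faceInt_congr fun z r hr => t4 n _ (facePoint_mem_closure_dihedral hab hθ z hr)
  rw [setIntegral_congr_fun hm fun x hx => t1 x (hDC hx),
    setIntegral_congr_fun hm fun x hx => t2 x (hDC hx),
    hf3 b (right_mem_Icc.2 hab.le), hf4 b (right_mem_Icc.2 hab.le),
    hf3 a (left_mem_Icc.2 hab.le), hf4 a (left_mem_Icc.2 hab.le)] at hgreen
  simp only [neg_mul, map_neg, mul_neg, integral_neg]
  linear_combination -hgreen

theorem rotDilY_facePoint (χ ψ b : ℝ) (z : Fin d → ℝ) (r : ℝ) :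
    rotDilY d χ ψ (facePoint b (z, r)) = facePoint (b + ψ) (z, χ * r) := by
  simp only [rotDilY, facePoint, cos_add, sin_add, Prod.mk.injEq, and_true]
  constructor <;> ring

theorem continuous_rotDilY (χ ψ : ℝ) : Continuous (rotDilY d χ ψ) := by
  unfold rotDilY
  fun_prop

theorem rotDilY_inv_rotDilY {χ : ℝ} (hχ : χ ≠ 0) (ψ : ℝ) (x : (ℝ × ℝ) × (Fin d → ℝ)) :
    rotDilY d (1 / χ) (-ψ) (rotDilY d χ ψ x) = x := by
  obtain ⟨⟨y₁, y₂⟩, z⟩ := x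
  simp only [rotDilY, cos_neg, sin_neg, Prod.mk.injEq, and_true]
  constructor <;> field_simp
  · linear_combination y₁ * cos_sq_add_sin_sq ψ
  · linear_combination y₂ * cos_sq_add_sin_sq ψ

/-- Change of variables between faces under a rotation combined with a dilation. -/
theorem faceInt_mul_comp_rotDilY {χ : ℝ} (hχ : 0 < χ) (b ψ : ℝ)
    (f g : (ℝ × ℝ) × (Fin d → ℝ) → ℂ) :
    faceInt d b (fun x => f (rotDilY d χ ψ x) * g x) =
      faceInt d (b + ψ) (fun x => f x * (((1 / χ : ℝ) : ℂ) * g (rotDilY d (1 / χ) (-ψ) x))) := by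
  refine integral_congr_ae (.of_forall fun z => ?_)
  have h := integral_comp_mul_left_Ioi (fun ρ => f (facePoint (b + ψ) (z, ρ)) *
    g (facePoint b (z, 1 / χ * ρ))) 0 hχ
  rw [mul_zero, ← integral_smul] at h
  convert h using 1
  · refine setIntegral_congr_fun measurableSet_Ioi fun r _ => ?_
    have e : 1 / χ * (χ * r) = r := by field_simp
    simp only [e, ← rotDilY_facePoint]
    rfl
  · refine setIntegral_congr_fun measurableSet_Ioi fun r _ => ?_
    have e := rotDilY_facePoint (1 / χ) (-ψ) (b + ψ) z r
    rw [add_neg_cancel_right] at e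
    change _ = χ⁻¹ • (f (facePoint (b + ψ) (z, r)) * g (facePoint b (z, 1 / χ * r)))
    rw [← e, Complex.real_smul, ← one_div]
    exact mul_left_comm _ _ _

end Dihedral

/-- Nonlocal Green formula for `-Δ` in the dihedral angle `Ω = K × ℝ^d` with the nonlocal
Dirichlet-type boundary operator `U|_{Γ₁} + α U(χ₁₂ r, φ + φ₁₂, z)|_{Γ₁}`. -/
theorem green_formula_nonlocal_dirichlet_dihedral
    (b₁ b₂ b₃ : ℝ) (hb₀ : 0 < b₁) (hb₁₂ : b₁ < b₂) (hb₂₃ : b₂ < b₃) (hb₃ : b₃ < 2 * π)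
    (hd : 1 ≤ d) (α χ₁₂ : ℝ) (hχ : 0 < χ₁₂)
    (U V₁ V₂ : (ℝ × ℝ) × (Fin d → ℝ) → ℂ)
    (hU : SmoothNear3 d U (closure (dihedral d b₁ b₃) \ edge d))
    (hUc : HasCompactSupport U) (hU0 : Disjoint (tsupport U) (edge d))
    (hV₁ : SmoothNear3 d V₁ (closure (dihedral d b₁ b₂) \ edge d))
    (hV₂ : SmoothNear3 d V₂ (closure (dihedral d b₂ b₃) \ edge d)) :
    ((∫ x in dihedral d b₁ b₂, (-(lap3 d U x)) * conj (V₁ x)) +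
      (∫ x in dihedral d b₂ b₃, (-(lap3 d U x)) * conj (V₂ x))) +
    faceInt d b₁ (fun x => (U x + (α : ℂ) * U (rotDilY d χ₁₂ (b₂ - b₁) x)) *
      conj (dd3 d V₁ ((-Real.sin b₁, Real.cos b₁), 0) x)) +
    faceInt d b₃ (fun x => U x * conj (dd3 d V₂ ((Real.sin b₃, -Real.cos b₃), 0) x)) +
    faceInt d b₂ (fun x => dd3 d U ((-Real.sin b₂, Real.cos b₂), 0) x *
      (conj (V₁ x) - conj (V₂ x))) =
    ((∫ x in dihedral d b₁ b₂, U x * conj (-(lap3 d V₁ x))) +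
      (∫ x in dihedral d b₂ b₃, U x * conj (-(lap3 d V₂ x)))) +
    faceInt d b₁ (fun x => dd3 d U ((-Real.sin b₁, Real.cos b₁), 0) x * conj (V₁ x)) +
    faceInt d b₃ (fun x => dd3 d U ((Real.sin b₃, -Real.cos b₃), 0) x * conj (V₂ x)) +
    faceInt d b₂ (fun x => U x * conj (dd3 d V₁ ((-Real.sin b₂, Real.cos b₂), 0) x -
      dd3 d V₂ ((-Real.sin b₂, Real.cos b₂), 0) x +
      (α : ℂ) * ((1 / χ₁₂ : ℝ) : ℂ) *
        dd3 d V₁ ((-Real.sin b₁, Real.cos b₁), 0) (rotDilY d (1 / χ₁₂) (-(b₂ - b₁)) x))) := by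
  have hπ₁₂ : b₂ - b₁ ≤ 2 * π := by linarith
  have hπ₂₃ : b₃ - b₂ ≤ 2 * π := by linarith
  set C₁ := closure (dihedral d b₁ b₂) \ edge d
  set C₂ := closure (dihedral d b₂ b₃) \ edge d
  have hU₁ : SmoothNear3 d U C₁ :=
    hU.mono (sdiff_subset_sdiff_left (closure_mono (dihedral_mono le_rfl hb₂₃.le)))
  have hU₂ : SmoothNear3 d U C₂ :=
    hU.mono (sdiff_subset_sdiff_left (closure_mono (dihedral_mono hb₁₂.le le_rfl)))
  have hΓ₁ := image_facePoint_subset (d := d) hb₁₂ (left_mem_Icc.2 hb₁₂.le)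
  have hΓ₂ := image_facePoint_subset (d := d) hb₁₂ (right_mem_Icc.2 hb₁₂.le)
  have hΓ₂' := image_facePoint_subset (d := d) hb₂₃ (left_mem_Icc.2 hb₂₃.le)
  have hconj : ∀ {f : (ℝ × ℝ) × (Fin d → ℝ) → ℂ} {s : Set ((ℝ × ℝ) × (Fin d → ℝ))},
      ContinuousOn f s → ContinuousOn (fun x => conj (f x)) s := fun hf =>
    Complex.continuous_conj.comp_continuousOn hf
  have hUz : ∀ x ∉ tsupport U, U x = 0 := fun x hx => image_eq_zero_of_notMem_tsupport hx
  have hdUz : ∀ n, ∀ x ∉ tsupport U, dd3 d U n x = 0 := fun n x hx =>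
    image_eq_zero_of_notMem_tsupport fun h => hx (tsupport_fderiv_apply_subset ℝ n h)
  have hmap : ∀ x ∈ facePoint (d := d) b₁ '' {p | 0 < p.2},
      rotDilY d χ₁₂ (b₂ - b₁) x ∈ facePoint (d := d) b₂ '' {p | 0 < p.2} := by
    rintro _ ⟨⟨z, r⟩, hr, rfl⟩
    refine ⟨(z, χ₁₂ * r), mul_pos hχ hr, ?_⟩
    rw [rotDilY_facePoint, add_sub_cancel]
  have hmap' : ∀ x ∈ facePoint (d := d) b₂ '' {p | 0 < p.2},
      rotDilY d (1 / χ₁₂) (-(b₂ - b₁)) x ∈ facePoint (d := d) b₁ '' {p | 0 < p.2} := by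
    rintro _ ⟨⟨z, r⟩, hr, rfl⟩
    refine ⟨(z, 1 / χ₁₂ * r), mul_pos (one_div_pos.2 hχ) hr, ?_⟩
    rw [rotDilY_facePoint]
    congr 1
    ring
  have i₁ : FaceIntegrable b₁ (fun x => U x * conj (dd3 d V₁ ((-sin b₁, cos b₁), 0) x)) :=
    faceIntegrable_of_disjoint_edge hUc hU0 (fun x hx => by rw [hUz x hx, zero_mul])
      ((hU₁.continuousOn.mul (hconj (hV₁.continuousOn_dd3 _))).mono hΓ₁)
  have hrot_edge : ∀ x ∈ edge d, rotDilY d χ₁₂ (b₂ - b₁) x ∈ edge d := by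
    rintro ⟨y, z⟩ ⟨hy, -⟩
    obtain rfl : y = 0 := hy
    exact ⟨by simp [rotDilY], mem_univ _⟩
  have hrot_compact : IsCompact (rotDilY d χ₁₂ (b₂ - b₁) ⁻¹' tsupport U) := by
    refine (hUc.isCompact.image (continuous_rotDilY (1 / χ₁₂) (-(b₂ - b₁)))).of_isClosed_subset
      ((isClosed_tsupport U).preimage (continuous_rotDilY _ _)) fun x hx => ?_
    exact ⟨_, hx, rotDilY_inv_rotDilY hχ.ne' _ x⟩
  have i₁₀ : FaceIntegrable b₁ (fun x => U (rotDilY d χ₁₂ (b₂ - b₁) x) *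
      conj (dd3 d V₁ ((-sin b₁, cos b₁), 0) x)) :=
    faceIntegrable_of_disjoint_edge hrot_compact
      (disjoint_left.2 fun x hx he => hU0.le_bot ⟨hx, hrot_edge x he⟩)
      (fun x hx => by rw [hUz _ hx, zero_mul])
      (((hU₁.continuousOn.mono hΓ₂).comp (continuous_rotDilY _ _).continuousOn hmap).mul
        ((hconj (hV₁.continuousOn_dd3 _)).mono hΓ₁))
  have i₁' : FaceIntegrable b₁ (fun x => (α : ℂ) * (U (rotDilY d χ₁₂ (b₂ - b₁) x) *
      conj (dd3 d V₁ ((-sin b₁, cos b₁), 0) x))) := i₁₀.const_mul _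
  have i₂ : FaceIntegrable b₂ (fun x => dd3 d U ((-sin b₂, cos b₂), 0) x * conj (V₁ x)) :=
    faceIntegrable_of_disjoint_edge hUc hU0 (fun x hx => by rw [hdUz _ x hx, zero_mul])
      (((hU₁.continuousOn_dd3 _).mul (hconj hV₁.continuousOn)).mono hΓ₂)
  have i₂' : FaceIntegrable b₂ (fun x => dd3 d U ((-sin b₂, cos b₂), 0) x * conj (V₂ x)) :=
    faceIntegrable_of_disjoint_edge hUc hU0 (fun x hx => by rw [hdUz _ x hx, zero_mul])
      (((hU₂.continuousOn_dd3 _).mul (hconj hV₂.continuousOn)).mono hΓ₂')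
  have j₂ : FaceIntegrable b₂ (fun x => U x * conj (dd3 d V₁ ((-sin b₂, cos b₂), 0) x)) :=
    faceIntegrable_of_disjoint_edge hUc hU0 (fun x hx => by rw [hUz x hx, zero_mul])
      ((hU₁.continuousOn.mul (hconj (hV₁.continuousOn_dd3 _))).mono hΓ₂)
  have j₂' : FaceIntegrable b₂ (fun x => U x * conj (dd3 d V₂ ((-sin b₂, cos b₂), 0) x)) :=
    faceIntegrable_of_disjoint_edge hUc hU0 (fun x hx => by rw [hUz x hx, zero_mul])
      ((hU₂.continuousOn.mul (hconj (hV₂.continuousOn_dd3 _))).mono hΓ₂')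
  have j₂s : FaceIntegrable b₂ (fun x => U x * conj (dd3 d V₁ ((-sin b₂, cos b₂), 0) x) -
      U x * conj (dd3 d V₂ ((-sin b₂, cos b₂), 0) x)) := j₂.sub j₂'
  have k₀ : FaceIntegrable b₂ (fun x => U x * (((1 / χ₁₂ : ℝ) : ℂ) *
      conj (dd3 d V₁ ((-sin b₁, cos b₁), 0) (rotDilY d (1 / χ₁₂) (-(b₂ - b₁)) x)))) :=
    faceIntegrable_of_disjoint_edge hUc hU0 (fun x hx => by rw [hUz x hx, zero_mul])
      ((hU₁.continuousOn.mono hΓ₂).mul (continuousOn_const.mul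
        (((hconj (hV₁.continuousOn_dd3 _)).mono hΓ₁).comp
          (continuous_rotDilY _ _).continuousOn hmap')))
  have k₂ : FaceIntegrable b₂ (fun x => (α : ℂ) * (U x * (((1 / χ₁₂ : ℝ) : ℂ) *
      conj (dd3 d V₁ ((-sin b₁, cos b₁), 0) (rotDilY d (1 / χ₁₂) (-(b₂ - b₁)) x))))) :=
    k₀.const_mul _
  have g₁ := green_formula_dihedral hb₁₂ hπ₁₂ hU₁ hUc hU0 hV₁
  have g₂ := green_formula_dihedral hb₂₃ hπ₂₃ hU₂ hUc hU0 hV₂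
  have hscale := faceInt_mul_comp_rotDilY hχ b₁ (b₂ - b₁) U
    (fun x => conj (dd3 d V₁ ((-sin b₁, cos b₁), 0) x))
  rw [add_sub_cancel] at hscale
  have e₁ : faceInt d b₁ (fun x => (U x + (α : ℂ) * U (rotDilY d χ₁₂ (b₂ - b₁) x)) *
      conj (dd3 d V₁ ((-sin b₁, cos b₁), 0) x)) = _ :=
    (congrArg (faceInt d b₁) (funext fun x => by ring)).trans (faceInt_add i₁ i₁')
  have e₂ : faceInt d b₂ (fun x => dd3 d U ((-sin b₂, cos b₂), 0) x *
      (conj (V₁ x) - conj (V₂ x))) = _ :=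
    (congrArg (faceInt d b₂) (funext fun x => by ring)).trans (faceInt_sub i₂ i₂')
  have e₃ : faceInt d b₂ (fun x => U x * conj (dd3 d V₁ ((-sin b₂, cos b₂), 0) x -
      dd3 d V₂ ((-sin b₂, cos b₂), 0) x + (α : ℂ) * ((1 / χ₁₂ : ℝ) : ℂ) *
        dd3 d V₁ ((-sin b₁, cos b₁), 0) (rotDilY d (1 / χ₁₂) (-(b₂ - b₁)) x))) = _ :=
    (congrArg (faceInt d b₂) (funext fun x => by
      simp only [map_add, map_sub, map_mul, Complex.conj_ofReal]
      ring)).trans (faceInt_add j₂s k₂)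
  have hneg : ∀ (W : (ℝ × ℝ) × (Fin d → ℝ) → ℂ) x, dd3 d W ((sin b₃, -cos b₃), 0) x =
      -1 * dd3 d W ((-sin b₃, cos b₃), 0) x := by
    intro W x
    have : (((sin b₃, -cos b₃), 0) : (ℝ × ℝ) × (Fin d → ℝ)) = -((-sin b₃, cos b₃), 0) := by simp
    rw [dd3, this, map_neg, neg_one_mul]
    rfl
  have e₄ : faceInt d b₃ (fun x => U x * conj (dd3 d V₂ ((sin b₃, -cos b₃), 0) x)) =
      -1 * faceInt d b₃ (fun x => U x * conj (dd3 d V₂ ((-sin b₃, cos b₃), 0) x)) := by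
    simp only [← faceInt_const_mul, hneg, map_mul, map_neg, map_one, mul_left_comm]
  have e₅ : faceInt d b₃ (fun x => dd3 d U ((sin b₃, -cos b₃), 0) x * conj (V₂ x)) =
      -1 * faceInt d b₃ (fun x => dd3 d U ((-sin b₃, cos b₃), 0) x * conj (V₂ x)) := by
    simp only [← faceInt_const_mul, hneg, mul_assoc]
  rw [e₁, e₂, e₃, e₄, e₅, faceInt_sub j₂ j₂', faceInt_const_mul, faceInt_const_mul, hscale]
  linear_combination g₁ + g₂
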